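/- Let n ≥ 2 and s ≥ n+3 with s − 1 ≥ n+3, suppose L = L_{n,d}(m_1,…,m_s) ≠ 0 and that for some index i one has 0 < m_i < k_C. Then dim L_{n,d}(m_1,…,m_s) = dim L_{n,d}(m_1,…,m_{i−1}, m_{i+1},…,m_s), i.e. the conditions imposed at the redundant point p_i do not change the dimension of the linear system. -/

import Mathlib

open Finset

noncomputable section

/-- Binomial coefficient `C(a,k)` with integer arguments; zero if `k < 0` or `a < k`. -/
def Cb (a k : ℤ) : ℤ := if 0 ≤ k ∧ k ≤ a then (Nat.choose a.toNat k.toNat : ℤ) else 0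

/-- Iterated partial derivative along a list of coordinate directions, as a linear map. -/
def derivAlong {n : ℕ} (D : List (Fin (n+1))) :
    MvPolynomial (Fin (n+1)) ℂ →ₗ[ℂ] MvPolynomial (Fin (n+1)) ℂ :=
  D.foldr (fun j f => (MvPolynomial.pderiv j).toLinearMap.comp f) LinearMap.id

/-- The point `(1, u, u², …, uⁿ) ∈ ℂ^{n+1}` on the affine cone over the
rational normal curve of degree `n`. -/
def rncPoint (n : ℕ) (u : ℂ) : Fin (n+1) → ℂ := fun j => u ^ (j : ℕ)

/-- The linear system `L_{n,d}(m_1,…,m_s)`: homogeneous polynomials of degree `d`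
in `x_0,…,x_n` all of whose partial derivatives of total order `≤ m_i − 1`
vanish at the point `p_i = (1, t_i, …, t_iⁿ)`. -/
def linSys (n d s : ℕ) (m : Fin s → ℕ) (tp : Fin s → ℂ) :
    Submodule ℂ (MvPolynomial (Fin (n+1)) ℂ) :=
  MvPolynomial.homogeneousSubmodule (Fin (n+1)) ℂ d ⊓
    ⨅ (i : Fin s), ⨅ (D : List (Fin (n+1))), ⨅ (_ : D.length < m i),
      LinearMap.ker
        ((MvPolynomial.aeval (rncPoint n (tp i))).toLinearMap.comp (derivAlong D))

/-- `k_C = ⌈(m_1+⋯+m_s − nd)/(s−n−2)⌉`. -/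
def kC (n d s : ℕ) (m : Fin s → ℕ) : ℤ :=
  ⌈((∑ i, (m i : ℚ)) - (n : ℚ) * d) / ((s : ℚ) - n - 2)⌉


/-- All partial derivatives of order `< k` vanish at the `A`-point `p`. -/
def VanD {n : ℕ} {A : Type} [CommRing A] [Algebra ℂ A] (k : ℕ)
    (P : MvPolynomial (Fin (n+1)) ℂ) (p : Fin (n+1) → A) : Prop :=
  ∀ D : List (Fin (n+1)), D.length < k → MvPolynomial.aeval p (derivAlong D P) = 0

theorem derivAlong_append {n : ℕ} (D : List (Fin (n+1))) (j : Fin (n+1))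
    (P : MvPolynomial (Fin (n+1)) ℂ) :
    derivAlong (D ++ [j]) P = derivAlong D (MvPolynomial.pderiv j P) := by
  induction D with
  | nil => simp [derivAlong]
  | cons a D ih =>
    simp only [derivAlong, List.cons_append, List.foldr_cons, LinearMap.comp_apply] at ih ⊢
    rw [ih]

theorem VanD.pderiv {n : ℕ} {A : Type} [CommRing A] [Algebra ℂ A] {k : ℕ}
    {P : MvPolynomial (Fin (n+1)) ℂ} {p : Fin (n+1) → A} (h : VanD (k+1) P p) (j : Fin (n+1)) :
    VanD k (MvPolynomial.pderiv j P) p := by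
  intro D hD
  rw [← derivAlong_append]
  exact h _ (by simpa using hD)

theorem chain_rule {n : ℕ} {B : Type} [CommRing B] [Algebra ℂ B] (D : Derivation ℂ B B)
    (f : Fin (n+1) → B) (P : MvPolynomial (Fin (n+1)) ℂ) :
    D (MvPolynomial.aeval f P) =
      ∑ j, MvPolynomial.aeval f (MvPolynomial.pderiv j P) * D (f j) := by
  induction P using MvPolynomial.induction_on with
  | C a => simp
  | add p q hp hq => simp [hp, hq, add_mul, Finset.sum_add_distrib]
  | mul_X p i hp =>
    have h1 : ∀ j, MvPolynomial.pderiv j (p * MvPolynomial.X i : MvPolynomial (Fin (n+1)) ℂ) =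
        MvPolynomial.pderiv j p * MvPolynomial.X i + p * (if i = j then 1 else 0) := by
      intro j
      rw [MvPolynomial.pderiv_mul, MvPolynomial.pderiv_X]
      simp [Pi.single_apply]
    simp only [h1, map_mul, map_add, MvPolynomial.aeval_X, Derivation.leibniz, hp, smul_eq_mul,
      add_mul, Finset.sum_add_distrib]
    rw [Finset.mul_sum, add_comm]
    congr 1
    · exact Finset.sum_congr rfl fun j _ => by ring
    · rw [Finset.sum_eq_single i]
      · simp
      · intro b _ hb
        simp [Ne.symm hb]
      · simp

theorem aeval_hom {n : ℕ} {A B : Type} [CommRing A] [Algebra ℂ A] [CommRing B] [Algebra ℂ B]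
    (φ : A →ₐ[ℂ] B) (f : Fin (n+1) → A) (P : MvPolynomial (Fin (n+1)) ℂ) :
    φ (MvPolynomial.aeval f P) = MvPolynomial.aeval (fun j => φ (f j)) P := by
  have : φ.comp (MvPolynomial.aeval f) = MvPolynomial.aeval (fun j => φ (f j)) := by
    ext j; simp
  exact DFunLike.congr_fun this P

theorem VanD.X_pow_dvd {n : ℕ} {A : Type} [CommRing A] [Algebra ℂ A] {k : ℕ}
    {P : MvPolynomial (Fin (n+1)) ℂ} {p : Fin (n+1) → A} (h : VanD k P p)
    (w : Fin (n+1) → A) :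
    (Polynomial.X : Polynomial A) ^ k ∣
      MvPolynomial.aeval (fun j => Polynomial.C (p j) + Polynomial.X * Polynomial.C (w j)) P := by
  induction k generalizing P with
  | zero => simp
  | succ k ih =>
    set f : Fin (n+1) → Polynomial A :=
      fun j => Polynomial.C (p j) + Polynomial.X * Polynomial.C (w j) with hf
    rw [Polynomial.X_pow_dvd_iff]
    intro d hd
    have hder := chain_rule
      ((Polynomial.derivative' : Derivation A (Polynomial A) (Polynomial A)).restrictScalars ℂ) f P
    have hdvd : (Polynomial.X : Polynomial A) ^ k ∣
        Polynomial.derivative (MvPolynomial.aeval f P) := by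
      have : Polynomial.derivative (MvPolynomial.aeval f P) = _ := hder
      rw [this]
      exact Finset.dvd_sum fun j _ => Dvd.dvd.mul_right (ih (h.pderiv j)) _
    rw [Polynomial.X_pow_dvd_iff] at hdvd
    cases d with
    | zero =>
      have h0 := h [] (by simp)
      simp only [derivAlong, List.foldr_nil, LinearMap.id_apply] at h0
      have h3 := aeval_hom ((Polynomial.aeval (R := A) (0:A)).restrictScalars ℂ) f P
      have h4 : (fun j => ((Polynomial.aeval (R := A) (0:A)).restrictScalars ℂ) (f j)) = p := by
        ext j; simp [hf]
      rw [h4, h0] at h3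
      rw [Polynomial.coeff_zero_eq_aeval_zero]
      exact h3
    | succ d =>
      have h1 := hdvd d (by omega)
      rw [Polynomial.coeff_derivative] at h1
      have h2 : IsUnit ((d : A) + 1) := by
        have : ((d : A) + 1) = algebraMap ℂ A ((d : ℂ) + 1) := by simp
        rw [this]
        exact (IsUnit.mk0 _ (by exact_mod_cast Nat.succ_ne_zero d)).map _
      exact (h2.mul_left_eq_zero).1 h1

theorem VanD.pow_dvd {n : ℕ} {A : Type} [CommRing A] [Algebra ℂ A] {k : ℕ}
    {P : MvPolynomial (Fin (n+1)) ℂ} {p : Fin (n+1) → A} (h : VanD k P p)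
    (g : A) (w : Fin (n+1) → A) :
    g ^ k ∣ MvPolynomial.aeval (fun j => p j + g * w j) P := by
  have h1 := map_dvd ((Polynomial.aeval (R := A) g).restrictScalars ℂ) (h.X_pow_dvd w)
  rw [aeval_hom] at h1
  have h2 : (fun j => ((Polynomial.aeval (R := A) g).restrictScalars ℂ)
      (Polynomial.C (p j) + Polynomial.X * Polynomial.C (w j))) = fun j => p j + g * w j := by
    ext j
    simp only [AlgHom.restrictScalars_apply, map_add, map_mul, Polynomial.aeval_X,
      Polynomial.aeval_C, Algebra.algebraMap_self, RingHom.id_apply]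
  rw [h2] at h1
  simpa using h1

theorem VanD.map {n : ℕ} {A B : Type} [CommRing A] [Algebra ℂ A] [CommRing B] [Algebra ℂ B]
    (φ : A →ₐ[ℂ] B) {k : ℕ}
    {P : MvPolynomial (Fin (n+1)) ℂ} {p : Fin (n+1) → A} (h : VanD k P p) :
    VanD k P (fun j => φ (p j)) := by
  intro D hD
  rw [← aeval_hom, h D hD, map_zero]

theorem aeval_homog {n d : ℕ} {A : Type} [CommRing A] [Algebra ℂ A]
    {P : MvPolynomial (Fin (n+1)) ℂ} (hP : P.IsHomogeneous d) (z : A) (q : Fin (n+1) → A) :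
    MvPolynomial.aeval (fun j => z * q j) P = z ^ d * MvPolynomial.aeval q P := by
  rw [MvPolynomial.aeval_def, MvPolynomial.aeval_def, MvPolynomial.eval₂_eq', MvPolynomial.eval₂_eq',
    Finset.mul_sum]
  refine Finset.sum_congr rfl fun e he => ?_
  have hd : ∑ i, e i = d := by
    have := hP.degree_eq_sum_deg_support he
    rw [← Finsupp.degree_eq_sum]
    exact this.symm
  simp only [mul_pow, Finset.prod_mul_distrib, Finset.prod_pow_eq_pow_sum, hd]
  ring

theorem coeff_lin {n : ℕ} (w : Fin (n+1) → ℂ) (i : ℕ) (G : MvPolynomial (Fin (n+1)) ℂ) :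
    PowerSeries.coeff i (MvPolynomial.aeval
      (fun j => (PowerSeries.X : PowerSeries ℂ) * PowerSeries.C (w j)) G) =
    MvPolynomial.eval w (MvPolynomial.homogeneousComponent i G) := by
  induction G using MvPolynomial.induction_on' with
  | monomial e a =>
    have hm : (MvPolynomial.monomial e a).IsHomogeneous e.degree :=
      MvPolynomial.isHomogeneous_monomial a rfl
    rw [aeval_homog hm, MvPolynomial.homogeneousComponent_of_mem hm, PowerSeries.coeff_X_pow_mul']
    have : MvPolynomial.aeval (fun j => PowerSeries.C (w j)) (MvPolynomial.monomial e a) =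
        PowerSeries.C (MvPolynomial.eval w (MvPolynomial.monomial e a)) := by
      simp [MvPolynomial.aeval_monomial, MvPolynomial.eval_monomial, Finsupp.prod_fintype]
    rw [this]
    by_cases hi : i = e.degree
    · simp [hi]
    · rw [if_neg (fun h => hi h)]
      split_ifs with h
      · rw [PowerSeries.coeff_C, if_neg (by omega)]; simp
      · simp
  | add p q hp hq => simp [hp, hq]

/-- translation -/
def mvTrans {n : ℕ} (p : Fin (n+1) → ℂ) (P : MvPolynomial (Fin (n+1)) ℂ) :
    MvPolynomial (Fin (n+1)) ℂ :=
  MvPolynomial.aeval (fun j => MvPolynomial.X j + MvPolynomial.C (p j)) P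

theorem vanD_of_trans {n : ℕ} (p : Fin (n+1) → ℂ) (K : ℕ) (P : MvPolynomial (Fin (n+1)) ℂ)
    (h : ∀ e : Fin (n+1) →₀ ℕ, e.degree < K → (mvTrans p P).coeff e = 0) : VanD K P p := by
  induction K generalizing P with
  | zero => intro D hD; simp at hD
  | succ K ih =>
    intro D hD
    rcases List.eq_nil_or_concat D with rfl | ⟨D', j, rfl⟩
    · have h0 := h 0 (by simp)
      have h1 : (MvPolynomial.aeval (0 : Fin (n+1) → ℂ)) (mvTrans p P) = 0 := by
        rw [MvPolynomial.aeval_zero, MvPolynomial.constantCoeff_eq, h0, map_zero]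
      simp only [mvTrans, aeval_hom] at h1
      simpa [derivAlong] using h1
    · rw [List.concat_eq_append, derivAlong_append]
      refine ih (MvPolynomial.pderiv j P) (fun e he => ?_) D' (by simpa using hD)
      have hc := chain_rule (MvPolynomial.pderiv j)
        (fun j => MvPolynomial.X j + MvPolynomial.C (p j)) P
      rw [Finset.sum_eq_single j] at hc
      · simp only [map_add, MvPolynomial.pderiv_X_self, MvPolynomial.pderiv_C, add_zero,
          mul_one] at hc
        rw [mvTrans, ← hc, MvPolynomial.coeff_pderiv]
        have := h (e + Finsupp.single j 1) (by simp; omega)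
        rw [mvTrans] at this
        rw [this, zero_mul]
      · intro b _ hb
        simp [MvPolynomial.pderiv_X_of_ne hb]
      · simp

theorem vanD_of_coeff {n : ℕ} (p : Fin (n+1) → ℂ) (K : ℕ) (P : MvPolynomial (Fin (n+1)) ℂ)
    (h : ∀ w : Fin (n+1) → ℂ, ∀ i < K, PowerSeries.coeff i (MvPolynomial.aeval
      (fun j => PowerSeries.C (p j) + (PowerSeries.X : PowerSeries ℂ) * PowerSeries.C (w j)) P) = 0) :
    VanD K P p := by
  refine vanD_of_trans p K P fun e he => ?_
  have h1 : MvPolynomial.homogeneousComponent e.degree (mvTrans p P) = 0 := by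
    refine MvPolynomial.funext fun w => ?_
    rw [← coeff_lin, mvTrans, aeval_hom, map_zero, ← h w _ he]
    congr 3
    ext1 j
    simp [add_comm]
  have := MvPolynomial.coeff_homogeneousComponent e.degree (mvTrans p P) e
  rw [h1] at this
  simpa using this.symm

theorem secant_expand {A : Type} [CommRing A] (u h δ : A) (j : ℕ) :
    ∃ r, (1 - δ) * u ^ j + δ * (u + h) ^ j = (u + δ * h) ^ j + δ * h ^ 2 * r := by
  obtain ⟨r1, h1⟩ := Polynomial.powAddExpansion u h j
  obtain ⟨r2, h2⟩ := Polynomial.powAddExpansion u (δ * h) j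
  refine ⟨r1 - δ * r2, ?_⟩
  rw [h1, h2]; ring

/-- constants as an algebra map -/
def CAlg : Polynomial ℂ →ₐ[ℂ] PowerSeries (Polynomial ℂ) :=
  { (PowerSeries.C : Polynomial ℂ →+* PowerSeries (Polynomial ℂ)) with
    commutes' := fun r => by
      simp [PowerSeries.algebraMap_apply] }

theorem CAlg_apply (f : Polynomial ℂ) : CAlg f = PowerSeries.C f := rfl

theorem rescale_const (g f : Polynomial ℂ) :
    PowerSeries.rescale g (PowerSeries.C f) = PowerSeries.C f := by
  ext1 i
  rw [PowerSeries.coeff_rescale, PowerSeries.coeff_C]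
  split_ifs with h <;> simp [h]

/-- rescaling as an algebra map -/
def RAlg (g : Polynomial ℂ) : PowerSeries (Polynomial ℂ) →ₐ[ℂ] PowerSeries (Polynomial ℂ) :=
  { PowerSeries.rescale g with
    commutes' := fun r => by
      simp [PowerSeries.algebraMap_apply, rescale_const] }

theorem RAlg_apply (g : Polynomial ℂ) (f : PowerSeries (Polynomial ℂ)) :
    RAlg g f = PowerSeries.rescale g f := rfl

/-- evaluation at `u` of the coefficients as an algebra map -/
def EAlg (u : ℂ) : PowerSeries (Polynomial ℂ) →ₐ[ℂ] PowerSeries ℂ :=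
  { PowerSeries.map (Polynomial.evalRingHom u) with
    commutes' := fun r => by
      simp [PowerSeries.algebraMap_apply] }

theorem EAlg_apply (u : ℂ) (f : PowerSeries (Polynomial ℂ)) :
    EAlg u f = PowerSeries.map (Polynomial.evalRingHom u) f := rfl

/-- the pencil evaluation -/
def HH {n : ℕ} (P : MvPolynomial (Fin (n+1)) ℂ) (v : Fin (n+1) → Polynomial ℂ) :
    PowerSeries (Polynomial ℂ) :=
  MvPolynomial.aeval (fun j : Fin (n+1) => PowerSeries.C ((Polynomial.X : Polynomial ℂ) ^ (j:ℕ)) +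
    PowerSeries.X * PowerSeries.C (v j)) P

/-- the generic point of the curve -/
def gen (n : ℕ) : Fin (n+1) → Polynomial ℂ := fun j => Polynomial.X ^ (j:ℕ)

theorem HH_low {n k : ℕ} {P : MvPolynomial (Fin (n+1)) ℂ} (hk : VanD k P (gen n))
    (v : Fin (n+1) → Polynomial ℂ) : ∀ i < k, PowerSeries.coeff i (HH P v) = 0 := by
  have h := (hk.map CAlg).pow_dvd PowerSeries.X (fun j => PowerSeries.C (v j))
  exact PowerSeries.X_pow_dvd_iff.1 h

/-- bidegree bound -/
def DB (n e d : ℕ) (H : PowerSeries (Polynomial ℂ)) : Prop :=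
  ∀ k j, n * d + e * k < j + n * k → (PowerSeries.coeff k H).coeff j = 0

theorem DB.mul {n e d d' : ℕ} {H H' : PowerSeries (Polynomial ℂ)} (h : DB n e d H)
    (h' : DB n e d' H') : DB n e (d + d') (H * H') := by
  intro k j hkj
  rw [PowerSeries.coeff_mul, Polynomial.finsetSum_coeff]
  refine Finset.sum_eq_zero fun ab hab => ?_
  rw [Polynomial.coeff_mul]
  refine Finset.sum_eq_zero fun cd hcd => ?_
  rw [Finset.HasAntidiagonal.mem_antidiagonal] at hab hcd
  by_cases h1 : n * d + e * ab.1 < cd.1 + n * ab.1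
  · rw [h _ _ h1, zero_mul]
  · by_cases h2 : n * d' + e * ab.2 < cd.2 + n * ab.2
    · rw [h' _ _ h2, mul_zero]
    · exfalso
      rw [← hab, ← hcd] at hkj
      nlinarith

theorem DB.const {n e : ℕ} (c : ℂ) :
    DB n e 0 (algebraMap ℂ (PowerSeries (Polynomial ℂ)) c) := by
  intro k j hkj
  rw [PowerSeries.algebraMap_apply, PowerSeries.coeff_C]
  split_ifs with h
  · subst h
    rw [Polynomial.algebraMap_apply, Polynomial.coeff_C, if_neg (by omega)]
  · simp

theorem DB.one {n e : ℕ} : DB n e 0 1 := by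
  simpa using DB.const (n := n) (e := e) 1

theorem DB.pow {n e : ℕ} {H : PowerSeries (Polynomial ℂ)} (h : DB n e 1 H) (r : ℕ) :
    DB n e r (H ^ r) := by
  induction r with
  | zero => simpa using DB.one
  | succ r ih => rw [pow_succ]; exact ih.mul h

theorem DB.prod {n e : ℕ} {ι : Type} (s : Finset ι) (f : ι → PowerSeries (Polynomial ℂ))
    (r : ι → ℕ) (h : ∀ i, DB n e (r i) (f i)) : DB n e (∑ i ∈ s, r i) (∏ i ∈ s, f i) := by
  classical
  induction s using Finset.induction_on with
  | empty => simpa using DB.one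
  | insert a s ha ih => rw [Finset.prod_insert ha, Finset.sum_insert ha]; exact (h a).mul ih

theorem HH_deg {n d e : ℕ} {P : MvPolynomial (Fin (n+1)) ℂ} (hP : P.IsHomogeneous d)
    (v : Fin (n+1) → Polynomial ℂ) (hv : ∀ j, (v j).natDegree ≤ e) : DB n e d (HH P v) := by
  have hf : ∀ j : Fin (n+1), DB n e 1 (PowerSeries.C ((Polynomial.X : Polynomial ℂ) ^ (j:ℕ)) +
    PowerSeries.X * PowerSeries.C (v j)) := by
    intro j k i hki
    have hj := j.2
    rcases k with _ | _ | k
    · simp only [map_add, PowerSeries.coeff_zero_X_mul, add_zero, PowerSeries.coeff_zero_C]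
      rw [Polynomial.coeff_X_pow, if_neg (by omega)]
    · rw [map_add, PowerSeries.coeff_succ_X_mul, PowerSeries.coeff_C, if_neg (by omega), zero_add]
      simp only [PowerSeries.coeff_zero_C]
      refine Polynomial.coeff_eq_zero_of_natDegree_lt ?_
      have := hv j
      omega
    · rw [map_add, PowerSeries.coeff_succ_X_mul, PowerSeries.coeff_C, PowerSeries.coeff_C,
        if_neg (by omega), if_neg (by omega)]
      simp
  intro k j hkj
  rw [HH, MvPolynomial.aeval_def, MvPolynomial.eval₂_eq', map_sum, Polynomial.finsetSum_coeff]
  refine Finset.sum_eq_zero fun m hm => ?_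
  have hd : ∑ i, m i = d := by
    have := hP.degree_eq_sum_deg_support hm
    rw [← Finsupp.degree_eq_sum]
    exact this.symm
  have := (DB.const (n := n) (e := e) (P.coeff m)).mul
    (DB.prod Finset.univ _ _ (fun i => (hf i).pow (m i)))
  rw [hd, zero_add] at this
  exact this k j hkj

theorem HH_point {n k m : ℕ} {t : ℂ} {P : MvPolynomial (Fin (n+1)) ℂ}
    (hm : VanD m P (rncPoint n t)) (v : Fin (n+1) → Polynomial ℂ) :
    (Polynomial.X - Polynomial.C t) ^ (m - k) ∣ PowerSeries.coeff k (HH P v) := by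
  rcases le_or_gt m k with h | h
  · simp [Nat.sub_eq_zero_of_le h]
  have hq : ∀ j : Fin (n+1), ∃ q : Polynomial ℂ, Polynomial.X ^ (j:ℕ) =
      Polynomial.C (t ^ (j:ℕ)) + (Polynomial.X - Polynomial.C t) * q := by
    intro j
    obtain ⟨q, hq⟩ := sub_dvd_pow_sub_pow (Polynomial.X : Polynomial ℂ) (Polynomial.C t) (j:ℕ)
    exact ⟨q, by rw [← hq]; simp⟩
  choose q hq using hq
  set g : Polynomial ℂ := Polynomial.X - Polynomial.C t with hg
  have h1 := (hm.map (Algebra.ofId ℂ (PowerSeries (Polynomial ℂ)))).pow_dvd (PowerSeries.C g)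
    (fun j => PowerSeries.C (q j) + PowerSeries.X * PowerSeries.C (v j))
  have h2 : RAlg g (HH P v) = MvPolynomial.aeval (fun j =>
      Algebra.ofId ℂ (PowerSeries (Polynomial ℂ)) (rncPoint n t j) + PowerSeries.C g *
      (PowerSeries.C (q j) + PowerSeries.X * PowerSeries.C (v j))) P := by
    rw [HH, aeval_hom]
    congr 2
    ext1 j
    rw [RAlg_apply, map_add, map_mul, PowerSeries.rescale_X, rescale_const,
      rescale_const, hq j, Algebra.ofId_apply, PowerSeries.algebraMap_apply,
      Polynomial.algebraMap_apply, rncPoint]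
    simp only [map_add, map_mul, Algebra.algebraMap_self, RingHom.id_apply]
    ring
  rw [← h2, ← map_pow] at h1
  obtain ⟨r, hr⟩ := h1
  have h3 := congrArg (PowerSeries.coeff k) hr
  rw [RAlg_apply, PowerSeries.coeff_rescale, PowerSeries.coeff_C_mul] at h3
  have hg0 : g ^ k ≠ 0 := pow_ne_zero _ (Polynomial.X_sub_C_ne_zero t)
  refine ⟨PowerSeries.coeff k r, mul_left_cancel₀ hg0 ?_⟩
  rw [h3, ← mul_assoc, ← pow_add]
  congr 2
  omega

/-- the direction vector -/
def vv {n : ℕ} (x a : Fin (n+1) → ℂ) : Fin (n+1) → Polynomial ℂ := fun j =>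
  ∑ l, Polynomial.C (a l) * (∏ l' ∈ Finset.univ.erase l, (Polynomial.X - Polynomial.C (x l')) ^ 2) *
    Polynomial.C (x l ^ (j:ℕ))

theorem vv_deg {n : ℕ} (x a : Fin (n+1) → ℂ) (j : Fin (n+1)) : (vv x a j).natDegree ≤ 2 * n := by
  refine Polynomial.natDegree_sum_le_of_forall_le _ _ fun l _ => ?_
  refine (Polynomial.natDegree_mul_C_le _ _).trans ((Polynomial.natDegree_C_mul_le _ _).trans ?_)
  rw [Polynomial.natDegree_prod_of_monic _ _
    (fun i _ => (Polynomial.monic_X_sub_C _).pow 2)]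
  simp [Finset.card_erase_of_mem, mul_comm]

theorem HH_tangent {n d k : ℕ} {P : MvPolynomial (Fin (n+1)) ℂ} (hP : P.IsHomogeneous d)
    (hk : VanD k P (gen n)) (x a : Fin (n+1) → ℂ) (l : Fin (n+1)) :
    (Polynomial.X - Polynomial.C (x l)) ^ (2 * k) ∣ PowerSeries.coeff k (HH P (vv x a)) := by
  set g : Polynomial ℂ := Polynomial.X - Polynomial.C (x l) with hg
  set b : Polynomial ℂ := Polynomial.C (a l) *
    (∏ l' ∈ Finset.univ.erase l, (Polynomial.X - Polynomial.C (x l')) ^ 2) with hb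
  have hv : ∀ j, ∃ r, vv x a j = b * Polynomial.C (x l ^ (j:ℕ)) + g ^ 2 * r := by
    intro j
    have : g ^ 2 ∣ ∑ i ∈ Finset.univ.erase l, Polynomial.C (a i) *
      (∏ l' ∈ Finset.univ.erase i, (Polynomial.X - Polynomial.C (x l')) ^ 2) *
        Polynomial.C (x i ^ (j:ℕ)) := by
      refine Finset.dvd_sum fun i hi => Dvd.dvd.mul_right (Dvd.dvd.mul_left ?_ _) _
      refine Finset.dvd_prod_of_mem (fun l' => (Polynomial.X - Polynomial.C (x l')) ^ 2) ?_
      simp only [Finset.mem_erase, Finset.mem_univ, and_true, ne_eq] at hi ⊢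
      exact fun h => hi h.symm
    obtain ⟨r, hr⟩ := this
    refine ⟨r, ?_⟩
    rw [← hr, vv, ← Finset.add_sum_erase _ _ (Finset.mem_univ l)]
  choose r hr using hv
  have hz : IsUnit (1 + PowerSeries.X * PowerSeries.C b : PowerSeries (Polynomial ℂ)) := by
    rw [PowerSeries.isUnit_iff_constantCoeff]
    simp
  obtain ⟨ζ, hζ⟩ := hz.exists_right_inv
  set z : PowerSeries (Polynomial ℂ) := 1 + PowerSeries.X * PowerSeries.C b with hzd
  set U : PowerSeries (Polynomial ℂ) := PowerSeries.C Polynomial.X with hU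
  set δ : PowerSeries (Polynomial ℂ) := PowerSeries.X * PowerSeries.C b * ζ with hδ
  set h : PowerSeries (Polynomial ℂ) := - PowerSeries.C g with hh
  have hse : ∀ j : Fin (n+1), ∃ r, (1 - δ) * U ^ (j:ℕ) + δ * (U + h) ^ (j:ℕ) =
      (U + δ * h) ^ (j:ℕ) + δ * h ^ 2 * r := fun j => secant_expand U h δ j
  choose r' hr' using hse
  have hxl : U + h = PowerSeries.C (Polynomial.C (x l)) := by
    rw [hU, hh, hg, ← map_neg, ← map_add]; congr 1; ring
  have hzd1 : z * (1 - δ) = 1 := by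
    rw [hδ]; linear_combination (-(PowerSeries.X * PowerSeries.C b)) * hζ + hzd
  have hzd2 : z * δ = PowerSeries.X * PowerSeries.C b := by
    rw [hδ]; linear_combination (PowerSeries.X * PowerSeries.C b) * hζ
  have hpt : HH P (vv x a) = MvPolynomial.aeval (fun j : Fin (n+1) => z * ((U + δ * h) ^ (j:ℕ) +
      (PowerSeries.X * PowerSeries.C (g ^ 2)) *
        (PowerSeries.C b * ζ * r' j + ζ * PowerSeries.C (r j)))) P := by
    rw [HH]
    congr 2
    ext1 j
    have e1 := hr' j
    rw [hxl] at e1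
    rw [hr j]
    simp only [map_add, map_mul, map_pow] at e1 ⊢
    rw [← hU]
    have e2 : h ^ 2 = PowerSeries.C g ^ 2 := by rw [hh]; ring
    rw [e2] at e1
    linear_combination z * e1 - U ^ (j:ℕ) * hzd1 -
      (PowerSeries.C (Polynomial.C (x l))) ^ (j:ℕ) * hzd2 +
      z * PowerSeries.C g ^ 2 * r' j * hδ -
      PowerSeries.X * PowerSeries.C g ^ 2 * PowerSeries.C (r j) * hζ
  rw [aeval_homog hP] at hpt
  have hvan : VanD k P (fun j : Fin (n+1) => (U + δ * h) ^ (j:ℕ)) := by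
    have := hk.map (Polynomial.aeval (R := ℂ) (U + δ * h))
    simpa [gen] using this
  have hdv := hvan.pow_dvd (PowerSeries.X * PowerSeries.C (g ^ 2))
    (fun j => PowerSeries.C b * ζ * r' j + ζ * PowerSeries.C (r j))
  have hdv2 := hdv.mul_left (z ^ d)
  rw [← hpt] at hdv2
  obtain ⟨q, hq⟩ := hdv2
  rw [hq, mul_pow, mul_assoc, PowerSeries.coeff_X_pow_mul', if_pos le_rfl, ← map_pow,
    PowerSeries.coeff_C_mul, ← pow_mul]
  exact Dvd.intro _ rfl

theorem step {n d s k : ℕ} {m : Fin s → ℕ} {tp : Fin s → ℂ} (htp : Function.Injective tp)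
    {P : MvPolynomial (Fin (n+1)) ℂ} (hP : P.IsHomogeneous d)
    (hm : ∀ l, VanD (m l) P (rncPoint n (tp l)))
    (hk : VanD k P (gen n)) (hnum : n * d < (∑ l, (m l - k)) + 2 * k + n * k) :
    VanD (k+1) P (gen n) := by
  -- auxiliary points
  obtain ⟨y, hy⟩ : ∃ y : Fin s ⊕ Fin (n+1) → ℂ, Function.Injective y ∧ ∀ l, y (Sum.inl l) = tp l := by
    have hinf : (Set.range tp)ᶜ.Infinite := (Set.finite_range tp).infinite_compl
    have := hinf.to_subtype
    let f := Infinite.natEmbedding ↥(Set.range tp)ᶜ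
    refine ⟨Sum.elim tp (fun l => (f l : ℂ)), ?_, fun l => rfl⟩
    refine Function.Injective.sumElim htp ?_ ?_
    · intro a b hab
      exact Fin.ext (f.injective (Subtype.ext hab))
    · intro a b hab
      exact (f b).2 ⟨a, hab⟩
  obtain ⟨hyi, hyt⟩ := hy
  set x : Fin (n+1) → ℂ := fun l => y (Sum.inr l) with hx
  have hxi : Function.Injective x := hyi.comp Sum.inr_injective
  have hF : ∀ a : Fin (n+1) → ℂ, PowerSeries.coeff k (HH P (vv x a)) = 0 := by
    intro a
    by_contra hne
    set F := PowerSeries.coeff k (HH P (vv x a)) with hFd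
    let ex : Fin s ⊕ Fin (n+1) → ℕ := Sum.elim (fun l => m l - k) (fun _ => 2 * k)
    have hdvd : ∏ i, (Polynomial.X - Polynomial.C (y i)) ^ ex i ∣ F := by
      refine Fintype.prod_dvd_of_coprime ?_ ?_
      · intro i j hij
        exact (Polynomial.pairwise_coprime_X_sub_C hyi hij).pow
      · rintro (l | l)
        · rw [hyt]
          exact HH_point (hm l) _
        · exact HH_tangent hP hk x a l
    have hdeg := Polynomial.natDegree_le_of_dvd hdvd hne
    rw [Polynomial.natDegree_prod_of_monic _ _
      (fun i _ => (Polynomial.monic_X_sub_C _).pow _)] at hdeg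
    simp only [Polynomial.natDegree_pow, Polynomial.natDegree_X_sub_C, mul_one,
      Fintype.sum_sum_type, ex, Sum.elim_inl, Sum.elim_inr, Finset.sum_const, Finset.card_univ,
      Fintype.card_fin, smul_eq_mul] at hdeg
    have hlead : F.coeff F.natDegree ≠ 0 := by
      simpa using hne
    refine hlead (HH_deg hP (vv x a) (vv_deg x a) k _ ?_)
    nlinarith
  have hpt : ∀ u : ℂ, u ∉ Set.range x → VanD (k+1) P (rncPoint n u) := by
    intro u hu
    refine vanD_of_coeff _ _ _ fun w i hi => ?_
    set c : Fin (n+1) → ℂ := fun l => ∏ l' ∈ Finset.univ.erase l, (u - x l') ^ 2 with hc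
    have hc0 : ∀ l, c l ≠ 0 := by
      intro l
      refine Finset.prod_ne_zero_iff.2 fun l' _ => pow_ne_zero _ (sub_ne_zero.2 ?_)
      exact fun h => hu ⟨l', h.symm⟩
    have hdet : IsUnit (Matrix.vandermonde x).det :=
      IsUnit.mk0 _ (Matrix.det_vandermonde_ne_zero_iff.2 hxi)
    set β : Fin (n+1) → ℂ := Matrix.vecMul w (Matrix.vandermonde x)⁻¹ with hβ
    have hβw : Matrix.vecMul β (Matrix.vandermonde x) = w := by
      rw [hβ, Matrix.vecMul_vecMul, Matrix.nonsing_inv_mul _ hdet, Matrix.vecMul_one]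
    set a : Fin (n+1) → ℂ := fun l => β l / c l with ha
    have hev : ∀ j, (vv x a j).eval u = w j := by
      intro j
      rw [← hβw, vv, Polynomial.eval_finsetSum]
      simp only [Matrix.vecMul, dotProduct, Matrix.vandermonde_apply]
      refine Finset.sum_congr rfl fun l _ => ?_
      simp only [Polynomial.eval_mul, Polynomial.eval_C, Polynomial.eval_prod, Polynomial.eval_pow,
        Polynomial.eval_sub, Polynomial.eval_X]
      change β l / c l * c l * _ = _
      rw [div_mul_cancel₀ _ (hc0 l)]
    have hco : PowerSeries.coeff i (HH P (vv x a)) = 0 := by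
      rcases Nat.lt_succ_iff_lt_or_eq.1 hi with h | h
      · exact HH_low hk _ i h
      · rw [h]; exact hF a
    have h1 : EAlg u (HH P (vv x a)) = MvPolynomial.aeval (fun j => PowerSeries.C (rncPoint n u j) +
        (PowerSeries.X : PowerSeries ℂ) * PowerSeries.C (w j)) P := by
      rw [HH, aeval_hom]
      congr 2
      ext1 j
      rw [EAlg_apply, map_add, map_mul, PowerSeries.map_X, PowerSeries.map_C, PowerSeries.map_C]
      simp [rncPoint, hev]
    rw [← h1, EAlg_apply, PowerSeries.coeff_map, hco, map_zero]
  intro D hD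
  refine Polynomial.eq_zero_of_infinite_isRoot _ ?_
  refine Set.Infinite.mono ?_ (Set.finite_range x).infinite_compl
  intro u hu
  have h1 := hpt u hu D hD
  have h2 := aeval_hom (Polynomial.aeval (R := ℂ) u) (gen n) (derivAlong D P)
  have h3 : (fun j => Polynomial.aeval (R := ℂ) u (gen n j)) = rncPoint n u := by
    ext j; simp [gen, rncPoint]
  rw [h3, h1] at h2
  simpa [Polynomial.IsRoot, Polynomial.coe_aeval_eq_eval] using h2

theorem mem_linSys {n d s : ℕ} {m : Fin s → ℕ} {tp : Fin s → ℂ}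
    {P : MvPolynomial (Fin (n+1)) ℂ} : P ∈ linSys n d s m tp ↔
      P.IsHomogeneous d ∧ ∀ l, VanD (m l) P (rncPoint n (tp l)) := by
  simp [linSys, VanD, Submodule.mem_inf, Submodule.mem_iInf]

theorem linSys_update_eq (n d s : ℕ) (hs' : n + 3 ≤ s - 1)
    (m : Fin s → ℕ) (tp : Fin s → ℂ) (htp : Function.Injective tp)
    (i : Fin s) (hmik : (m i : ℤ) < kC n d s m) :
    linSys n d s m tp = linSys n d s (Function.update m i 0) tp := by
  have hq : (m i : ℤ) * ((s : ℤ) - n - 2) < (∑ l, (m l : ℤ)) - n * d := by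
    rw [kC, Int.lt_ceil] at hmik
    have hpos : (0:ℚ) < (s : ℚ) - n - 2 := by
      have : ((n + 3 + 1 : ℕ) : ℚ) ≤ s := by exact_mod_cast (by omega : n + 3 + 1 ≤ s)
      push_cast at this
      linarith
    rw [lt_div_iff₀ hpos] at hmik
    have h2 : (((m i : ℤ) * ((s : ℤ) - n - 2) : ℤ) : ℚ) <
        (((∑ l, (m l : ℤ)) - n * d : ℤ) : ℚ) := by
      push_cast
      simpa using hmik
    exact_mod_cast h2
  apply le_antisymm
  · intro P hP
    rw [mem_linSys] at hP ⊢
    refine ⟨hP.1, fun l D hD => hP.2 l D (hD.trans_le ?_)⟩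
    by_cases h : l = i
    · subst h; simp
    · simp [Function.update_of_ne h]
  · intro P hP
    rw [mem_linSys] at hP
    rw [mem_linSys]
    refine ⟨hP.1, fun l => ?_⟩
    by_cases h : l = i
    · subst h
      have key : ∀ k ≤ m l, VanD k P (gen n) := by
        intro k
        induction k with
        | zero => intro _ D hD; simp at hD
        | succ k ih =>
          intro hk
          refine step htp hP.1 hP.2 (ih (by omega)) ?_
          have h1 : (∑ j, (m j : ℤ)) = m l + ∑ j ∈ Finset.univ.erase l, (m j : ℤ) :=
            (Finset.add_sum_erase _ _ (Finset.mem_univ l)).symm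
          have h2 : (∑ j ∈ Finset.univ.erase l, ((m j : ℤ) - k)) ≤
              ((∑ j, (Function.update m l 0 j - k) : ℕ) : ℤ) := by
            rw [← Finset.add_sum_erase _ _ (Finset.mem_univ l)]
            push_cast
            refine le_add_of_nonneg_of_le (by positivity) (Finset.sum_le_sum fun j hj => ?_)
            rw [Function.update_of_ne (Finset.ne_of_mem_erase hj)]
            omega
          rw [Finset.sum_sub_distrib, Finset.sum_const, Finset.card_erase_of_mem (Finset.mem_univ l),
            Finset.card_univ, Fintype.card_fin, nsmul_eq_mul, Nat.cast_sub (by omega)] at h2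
          zify
          push_cast at h2 ⊢
          have h3 : (k : ℤ) * ((s : ℤ) - n - 3) ≤ m l * ((s : ℤ) - n - 3) := by
            refine mul_le_mul_of_nonneg_right (by omega) (by omega)
          nlinarith
      have := (key (m l) le_rfl).map (Polynomial.aeval (R := ℂ) (tp l))
      have h3 : (fun j => Polynomial.aeval (R := ℂ) (tp l) (gen n j)) = rncPoint n (tp l) := by
        ext j; simp [gen, rncPoint]
      rwa [h3] at this
    · have := hP.2 l
      rwa [Function.update_of_ne h] at this

/-- **Redundant points (Remark 1.6).** If `L = L_{n,d}(m_1,…,m_s)` is effective,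
`s − 1 ≥ n + 3`, and `0 < m_i < k_C` for some `i`, then dropping the conditions at the
redundant point `p_i` (i.e. replacing `m_i` by `0`) does not change the dimension. -/
theorem stmt_11 (n d s : ℕ) (hn : 2 ≤ n) (hs : n + 3 ≤ s) (hs' : n + 3 ≤ s - 1)
    (m : Fin s → ℕ) (tp : Fin s → ℂ) (htp : Function.Injective tp)
    (heff : linSys n d s m tp ≠ ⊥)
    (i : Fin s) (hmi : 0 < m i) (hmik : (m i : ℤ) < kC n d s m) :
    Module.finrank ℂ (linSys n d s m tp) =
      Module.finrank ℂ (linSys n d s (Function.update m i 0) tp) := by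
  rw [← linSys_update_eq n d s hs' m tp htp i hmik]

end
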